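/- arXiv:math/0603588 — 2 statements merged into one kernel-verified Lean document; each statement's English description precedes it below -/
import Mathlib

section
/- Let V be a C_2-cofinite vertex operator algebra and X = {x^α : α ∈ I} a set of homogeneous vectors whose images form a basis of V/C_2(V). Then V is spanned by vectors x^1_{-n_1} x^2_{-n_2} ⋯ x^k_{-n_k} 1 with n_1 > n_2 > ⋯ > n_k > 0 and x^i ∈ X. In particular, V is finitely generated. -/
/-- Generalized binomial coefficient `C(n, k)` for `n : ℤ`, valued in `ℂ`. -/
noncomputable def cbinom (n : ℤ) (k : ℕ) : ℂ :=
  (∏ i ∈ Finset.range k, ((n : ℂ) - (i : ℂ))) / (Nat.factorial k : ℂ)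

/-- A vertex operator algebra structure on a complex vector space `V`. -/
structure VOA (V : Type) [AddCommGroup V] [Module ℂ V] where
  mode : V → ℤ → Module.End ℂ V
  vacuum : V
  conformal : V
  grading : ℤ → Submodule ℂ V
  internal : Function.Bijective (DirectSum.coeLinearMap grading)
  mode_add : ∀ (u v : V) (n : ℤ), mode (u + v) n = mode u n + mode v n
  mode_smul : ∀ (c : ℂ) (u : V) (n : ℤ), mode (c • u) n = c • mode u n
  truncation : ∀ u v : V, ∃ N : ℤ, ∀ n : ℤ, N ≤ n → mode u n v = 0
  vacuum_mem : vacuum ∈ grading 0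
  conformal_mem : conformal ∈ grading 2
  vacuum_mode : ∀ (v : V) (n : ℤ), mode vacuum n v = if n = -1 then v else 0
  creation : ∀ (u : V) (n : ℤ), 0 ≤ n → mode u n vacuum = 0
  creation_neg_one : ∀ u : V, mode u (-1) vacuum = u
  L0_eigen : ∀ (n : ℤ) (u : V), u ∈ grading n → mode conformal 1 u = (n : ℂ) • u
  Lneg1_deriv : ∀ (u : V) (n : ℤ), mode (mode conformal 0 u) n = (-n : ℂ) • mode u (n - 1)
  grading_mode : ∀ (r s m : ℤ) (u v : V), u ∈ grading r → v ∈ grading s →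
    mode u m v ∈ grading (r + s - m - 1)
  bounded_below : ∃ N : ℤ, ∀ n : ℤ, n < N → grading n = ⊥
  fin_dim : ∀ n : ℤ, FiniteDimensional ℂ (grading n)
  borcherds : ∀ (p q r : ℤ) (u v w : V),
    (∑ᶠ i : ℕ, cbinom p i • mode (mode u (r + i) v) (p + q - i) w) =
    ∑ᶠ i : ℕ, ((-1 : ℂ) ^ i * cbinom r i) •
      (mode u (p + r - i) (mode v (q + i) w)
        - (-1 : ℂ) ^ r • mode v (q + r - i) (mode u (p + i) w))

variable {V : Type} [AddCommGroup V] [Module ℂ V]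

/-- Projection onto the weight-`n` subspace. -/
noncomputable def VOA.proj (d : VOA V) (n : ℤ) : V →ₗ[ℂ] V :=
  (d.grading n).subtype ∘ₗ (DirectSum.component ℂ ℤ (fun m => d.grading m) n) ∘ₗ
    (LinearEquiv.ofBijective (DirectSum.coeLinearMap d.grading) d.internal).symm.toLinearMap

/-- `Res_z (1+z)^N z^{-k} Y(u,z)v` for a vector `u` regarded as having weight contribution `N`. -/
noncomputable def VOA.hres (d : VOA V) (N k : ℤ) (u v : V) : V :=
  ∑ᶠ i : ℕ, cbinom N i • d.mode u ((i : ℤ) - k) v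

/-- `Res_z (1+z)^{wt u + m} z^{-k} Y(u,z)v`, extended bilinearly from homogeneous `u`. -/
noncomputable def VOA.bres (d : VOA V) (m k : ℤ) (u v : V) : V :=
  ∑ᶠ n : ℤ, d.hres (n + m) k (d.proj n u) v

/-- The Zhu product `u * v`. -/
noncomputable def VOA.star (d : VOA V) (u v : V) : V := d.bres 0 1 u v

/-- The Zhu circle product `u ∘ v`. -/
noncomputable def VOA.circ (d : VOA V) (u v : V) : V := d.bres 0 2 u v

/-- The subspace `O(V)` spanned by all `u ∘ v`. -/
def VOA.Ozhu (d : VOA V) : Submodule ℂ V := Submodule.span ℂ {w : V | ∃ u v : V, w = d.circ u v}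

/-- The product `u ∘_n v`. -/
noncomputable def VOA.circn (d : VOA V) (n : ℕ) (u v : V) : V := d.bres n (2 * n + 2) u v

/-- The product `u *_n v` of Dong–Li–Mason. -/
noncomputable def VOA.starn (d : VOA V) (n : ℕ) (u v : V) : V :=
  ∑ m ∈ Finset.range (n + 1),
    ((-1 : ℂ) ^ m * cbinom ((m : ℤ) + (n : ℤ)) n) • d.bres n ((n : ℤ) + (m : ℤ) + 1) u v

/-- The subspace `O_n(V)`. -/
def VOA.On (d : VOA V) (n : ℕ) : Submodule ℂ V :=
  Submodule.span ℂ ({w : V | ∃ u v : V, w = d.circn n u v} ∪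
    {w : V | ∃ u : V, w = d.mode d.conformal 0 u + d.mode d.conformal 1 u})

/-- The Dong–Jiang product `u *_{m,p}^n v`. -/
noncomputable def VOA.starmpn (d : VOA V) (m p n : ℕ) (u v : V) : V :=
  ∑ i ∈ Finset.range (p + 1),
    ((-1 : ℂ) ^ i * cbinom ((m : ℤ) + (n : ℤ) - (p : ℤ) + (i : ℤ)) i) •
      d.bres m ((m : ℤ) + (n : ℤ) - (p : ℤ) + (i : ℤ) + 1) u v

/-- The Dong–Jiang product `u ∘_m^n v`. -/
noncomputable def VOA.circmn (d : VOA V) (n m : ℕ) (u v : V) : V :=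
  d.bres m ((n : ℤ) + (m : ℤ) + 2) u v

/-- The subspace `O_{n,m}(V) = O'_{n,m}(V) + O''_{n,m}(V) + O'''_{n,m}(V)` of Dong–Jiang. -/
def VOA.Onm (d : VOA V) (n m : ℕ) : Submodule ℂ V :=
  Submodule.span ℂ (
    {w : V | ∃ u v : V, w = d.circmn n m u v} ∪
    {w : V | ∃ u : V, w = d.mode d.conformal 0 u + d.mode d.conformal 1 u
        + (((m : ℂ) - (n : ℂ)) • u)} ∪
    {w : V | ∃ (u a b c : V) (p₁ p₂ p₃ : ℕ), w = d.starmpn m p₃ n u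
        (d.starmpn m p₁ p₃ (d.starmpn p₁ p₂ p₃ a b) c
          - d.starmpn m p₂ p₃ a (d.starmpn m p₁ p₂ b c))} ∪
    {w : V | ∃ (p : ℕ) (u x v : V), x ∈ d.On p ∧ w = d.starmpn m p n (d.starmpn p p n u x) v})

/-- The subspace `C_2(V)` spanned by the `u_{-2} v`. -/
def VOA.C2 (d : VOA V) : Submodule ℂ V := Submodule.span ℂ {w : V | ∃ u v : V, w = d.mode u (-2) v}

/-- `V` is a simple vertex operator algebra: its only ideals are `0` and `V`. -/
def VOA.IsSimpleVOA (d : VOA V) : Prop :=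
  (∃ v : V, v ≠ 0) ∧ ∀ P : Submodule ℂ V,
    (∀ (u : V) (n : ℤ), ∀ w ∈ P, d.mode u n w ∈ P) → P = ⊥ ∨ P = ⊤

/-- A weak module for the vertex operator algebra `d`. -/
structure WeakMod (d : VOA V) (M : Type) [AddCommGroup M] [Module ℂ M] where
  act : V → ℤ → Module.End ℂ M
  act_add : ∀ (u v : V) (n : ℤ), act (u + v) n = act u n + act v n
  act_smul : ∀ (c : ℂ) (u : V) (n : ℤ), act (c • u) n = c • act u n
  truncation : ∀ (u : V) (w : M), ∃ N : ℤ, ∀ n : ℤ, N ≤ n → act u n w = 0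
  vacuum_act : ∀ (w : M) (n : ℤ), act d.vacuum n w = if n = -1 then w else 0
  borcherds : ∀ (p q r : ℤ) (u v : V) (w : M),
    (∑ᶠ i : ℕ, cbinom p i • act (d.mode u (r + i) v) (p + q - i) w) =
    ∑ᶠ i : ℕ, ((-1 : ℂ) ^ i * cbinom r i) •
      (act u (p + r - i) (act v (q + i) w)
        - (-1 : ℂ) ^ r • act v (q + r - i) (act u (p + i) w))

/-- An admissible (ℤ₊-graded) module for the vertex operator algebra `d`. -/
structure AdmMod (d : VOA V) (M : Type) [AddCommGroup M] [Module ℂ M]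
    extends WeakMod d M where
  gr : ℤ → Submodule ℂ M
  gr_internal : Function.Bijective (DirectSum.coeLinearMap gr)
  gr_neg : ∀ n : ℤ, n < 0 → gr n = ⊥
  gr_act : ∀ (r : ℤ) (u : V), u ∈ d.grading r → ∀ (m n : ℤ) (w : M), w ∈ gr n →
    act u m w ∈ gr (r + n - m - 1)

variable {M : Type} [AddCommGroup M] [Module ℂ M]

/-- The zero-mode `o(v) = v_{wt v - 1}`, extended linearly from homogeneous `v`. -/
noncomputable def WeakMod.o {d : VOA V} (W : WeakMod d M) (v : V) (w : M) : M :=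
  ∑ᶠ r : ℤ, W.act (d.proj r v) (r - 1) w

/-- The mode `o_t(v) = v_{wt v - 1 - t}`, extended linearly from homogeneous `v`. -/
noncomputable def WeakMod.ot {d : VOA V} (W : WeakMod d M) (t : ℤ) (v : V) (w : M) : M :=
  ∑ᶠ r : ℤ, W.act (d.proj r v) (r - 1 - t) w

/-- The subspace `Ω_n(M)` of a weak module. -/
def WeakMod.OmegaSet {d : VOA V} (W : WeakMod d M) (n : ℕ) : Set M :=
  {w : M | ∀ (r : ℤ) (u : V), u ∈ d.grading r → ∀ m : ℤ, m > r - 1 + (n : ℤ) → W.act u m w = 0}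

/-- A subspace stable under all modes. -/
def WeakMod.IsStable {d : VOA V} (W : WeakMod d M) (P : Submodule ℂ M) : Prop :=
  ∀ (u : V) (n : ℤ), ∀ w ∈ P, W.act u n w ∈ P

/-- A subspace compatible with the grading of an admissible module. -/
def AdmMod.IsGraded {d : VOA V} (A : AdmMod d M) (P : Submodule ℂ M) : Prop :=
  P = ⨆ n : ℤ, (P ⊓ A.gr n)

/-- `P` is an irreducible admissible submodule. -/
def AdmMod.IrredSub {d : VOA V} (A : AdmMod d M) (P : Submodule ℂ M) : Prop :=
  P ≠ ⊥ ∧ A.toWeakMod.IsStable P ∧ A.IsGraded P ∧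
    ∀ Q : Submodule ℂ M, Q ≤ P → A.toWeakMod.IsStable Q → A.IsGraded Q → Q = ⊥ ∨ Q = P

/-- The admissible module is irreducible. -/
def AdmMod.IsIrreducible {d : VOA V} (A : AdmMod d M) : Prop :=
  (∃ w : M, w ≠ 0) ∧
    ∀ P : Submodule ℂ M, A.toWeakMod.IsStable P → A.IsGraded P → P = ⊥ ∨ P = ⊤

/-- Rationality: every admissible module is a direct sum of irreducible admissible submodules. -/
def Rational (d : VOA V) : Prop :=
  ∀ (M : Type) [AddCommGroup M] [Module ℂ M] (A : AdmMod d M),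
    ∃ (ι : Type) (f : ι → Submodule ℂ M),
      (∀ i, A.IrredSub (f i)) ∧ iSupIndep f ∧ (⨆ i, f i) = ⊤

/-- Equivalence of admissible modules. -/
def AdmEquiv {d : VOA V} {M₁ M₂ : Type} [AddCommGroup M₁] [Module ℂ M₁]
    [AddCommGroup M₂] [Module ℂ M₂] (A₁ : AdmMod d M₁) (A₂ : AdmMod d M₂) : Prop :=
  ∃ e : M₁ ≃ₗ[ℂ] M₂, ∀ (u : V) (n : ℤ) (w : M₁), e (A₁.act u n w) = A₂.act u n (e w)

/-- An ordinary-module structure on a weak module: a `ℂ`-grading by finite dimensional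
`L(0)`-eigenspaces, bounded below in each coset of `ℤ`. -/
structure OrdinaryStruct {d : VOA V} (W : WeakMod d M) where
  grc : ℂ → Submodule ℂ M
  internal : Function.Bijective (DirectSum.coeLinearMap grc)
  eigen : ∀ (lam : ℂ) (w : M), w ∈ grc lam → W.act d.conformal 1 w = lam • w
  findim : ∀ lam : ℂ, FiniteDimensional ℂ (grc lam)
  bounded : ∀ lam : ℂ, ∃ N : ℤ, ∀ n : ℤ, n < N → grc (lam + (n : ℂ)) = ⊥

/-- An admissible module is ordinary. -/
def AdmMod.IsOrdinary {d : VOA V} (A : AdmMod d M) : Prop :=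
  Nonempty (OrdinaryStruct A.toWeakMod)

/-- A realization of the quotient associative algebra `V/Osub` with product induced by `mu`. -/
structure Realization (Osub : Submodule ℂ V) (mu : V → V → V) (one : V) where
  carrier : Type
  [ring : Ring carrier]
  [alg : Algebra ℂ carrier]
  emb : V →ₗ[ℂ] carrier
  surj : Function.Surjective emb
  ker_eq : LinearMap.ker emb = Osub
  mul_compat : ∀ u v : V, emb (mu u v) = emb u * emb v
  one_compat : emb one = 1

/-- The realized algebra is semisimple. -/
def Realization.Semisimple {Osub : Submodule ℂ V} {mu : V → V → V} {one : V}
    (R : Realization Osub mu one) : Prop :=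
  letI := R.ring; IsSemisimpleRing R.carrier

/-- The realized algebra is finite dimensional over `ℂ`. -/
def Realization.FinDim {Osub : Submodule ℂ V} {mu : V → V → V} {one : V}
    (R : Realization Osub mu one) : Prop :=
  letI := R.ring; letI := R.alg; FiniteDimensional ℂ R.carrier

/-- A module over the quotient algebra `V/Osub`, given as a representation of `V`
killing `Osub` and multiplicative for `mu`. -/
structure RepOf (Osub : Submodule ℂ V) (mu : V → V → V) (one : V)
    (U : Type) [AddCommGroup U] [Module ℂ U] where
  rep : V →ₗ[ℂ] Module.End ℂ U
  kills : ∀ v ∈ Osub, rep v = 0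
  mul_compat : ∀ u v : V, rep (mu u v) = rep u * rep v
  one_compat : rep one = 1

/-- Simplicity of such a representation. -/
def RepOf.IsSimple {Osub : Submodule ℂ V} {mu : V → V → V} {one : V}
    {U : Type} [AddCommGroup U] [Module ℂ U] (Z : RepOf Osub mu one U) : Prop :=
  (∃ u : U, u ≠ 0) ∧
    ∀ P : Submodule ℂ U, (∀ v : V, ∀ x ∈ P, Z.rep v x ∈ P) → P = ⊥ ∨ P = ⊤

/-- Equivalence of two such representations. -/
def RepEquiv {Osub : Submodule ℂ V} {mu : V → V → V} {one : V}
    {U₁ U₂ : Type} [AddCommGroup U₁] [Module ℂ U₁] [AddCommGroup U₂] [Module ℂ U₂]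
    (Z₁ : RepOf Osub mu one U₁) (Z₂ : RepOf Osub mu one U₂) : Prop :=
  ∃ e : U₁ ≃ₗ[ℂ] U₂, ∀ (v : V) (x : U₁), e (Z₁.rep v x) = Z₂.rep v (e x)

/-- The iterated mode application `x¹_{-n₁} x²_{-n₂} ⋯ x^k_{-n_k} 𝟙`. -/
noncomputable def VOA.modeSeq (d : VOA V) (k : ℕ) (xs : Fin k → V) (ns : Fin k → ℕ) : V :=
  (List.ofFn fun i => d.mode (xs i) (-(ns i : ℤ))).foldr (fun f w => f w) d.vacuum

namespace VOA

section Basic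

variable (d : VOA V)

theorem mode_zero_left (n : ℤ) : d.mode 0 n = 0 := by
  simpa using d.mode_smul 0 0 n

/-- The map `u ↦ u_n w`. -/
def modeLeft (n : ℤ) (w : V) : V →ₗ[ℂ] V where
  toFun u := d.mode u n w
  map_add' u v := by simp [d.mode_add]
  map_smul' c u := by simp [d.mode_smul]

theorem cbinom_zero_right (n : ℤ) : cbinom n 0 = 1 := by simp [cbinom]

theorem cbinom_zero_left {i : ℕ} (hi : i ≠ 0) : cbinom 0 i = 0 := by
  unfold cbinom
  rw [Finset.prod_eq_zero (Finset.mem_range.2 (Nat.pos_of_ne_zero hi)) (by simp)]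
  simp

theorem neg_one_pow_mul_cbinom (i : ℕ) : (-1 : ℂ) ^ i * cbinom (-1) i = 1 := by
  unfold cbinom
  rw [← mul_div_assoc, ← Finset.prod_range_add_one_eq_factorial, Nat.cast_prod]
  nth_rewrite 1 [← Finset.card_range i]
  rw [← Finset.prod_const, ← Finset.prod_mul_distrib, ← Finset.prod_div_distrib]
  refine Finset.prod_eq_one fun j _ => ?_
  have : (j : ℂ) + 1 ≠ 0 := by exact_mod_cast Nat.succ_ne_zero j
  push_cast
  field_simp
  ring

/-- The commutator formula. -/
theorem commutator (p q : ℤ) (u v w : V) :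
    d.mode u p (d.mode v q w) - d.mode v q (d.mode u p w) =
      ∑ᶠ i : ℕ, cbinom p i • d.mode (d.mode u i v) (p + q - i) w := by
  have h := d.borcherds p q 0 u v w
  rw [eq_comm, finsum_eq_single _ 0] at h
  · simpa [cbinom_zero_right] using h
  · intro i hi
    simp [cbinom_zero_left hi]

/-- The iterate formula. -/
theorem iterate (q r : ℤ) (u v w : V) :
    d.mode (d.mode u r v) q w = ∑ᶠ i : ℕ, ((-1 : ℂ) ^ i * cbinom r i) •
      (d.mode u (r - i) (d.mode v (q + i) w)
        - (-1 : ℂ) ^ r • d.mode v (q + r - i) (d.mode u i w)) := by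
  have h := d.borcherds 0 q r u v w
  rw [finsum_eq_single (fun i : ℕ => cbinom 0 i • _) 0] at h
  · simpa [cbinom_zero_right] using h
  · intro i hi
    simp [cbinom_zero_left hi]

theorem commutator_mem {P : Submodule ℂ V} {p q : ℤ} {u v w : V}
    (h : ∀ i : ℕ, d.mode (d.mode u i v) (p + q - i) w ∈ P) :
    d.mode u p (d.mode v q w) - d.mode v q (d.mode u p w) ∈ P := by
  rw [d.commutator]
  exact finsum_induction (· ∈ P) P.zero_mem (fun _ _ => P.add_mem) fun i => P.smul_mem _ (h i)

theorem iterate_mem {P : Submodule ℂ V} {q r : ℤ} {u v w : V}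
    (h₁ : ∀ i : ℕ, d.mode u (r - i) (d.mode v (q + i) w) ∈ P)
    (h₂ : ∀ i : ℕ, d.mode v (q + r - i) (d.mode u i w) ∈ P) :
    d.mode (d.mode u r v) q w ∈ P := by
  rw [d.iterate]
  exact finsum_induction (· ∈ P) P.zero_mem (fun _ _ => P.add_mem) fun i =>
    P.smul_mem _ (P.sub_mem (h₁ i) (P.smul_mem _ (h₂ i)))

theorem mem_of_finsum_mem {P : Submodule ℂ V} {f : ℕ → V} (hf : (Function.support f).Finite)
    {k : ℕ} (hne : ∀ i, i ≠ k → f i ∈ P) (hsum : ∑ᶠ i, f i ∈ P) : f k ∈ P := by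
  rw [← add_finsum_cond_ne k hf] at hsum
  refine (P.add_mem_iff_left ?_).1 hsum
  exact finsum_induction (· ∈ P) P.zero_mem (fun _ _ => P.add_mem) fun i =>
    finsum_induction (· ∈ P) P.zero_mem (fun _ _ => P.add_mem) fun hi => hne i hi

/-- Isolating one term in the expansion of `(u_{-1} v)_q w`. -/
theorem mode_mode_mem_of_iterate {P : Submodule ℂ V} {q : ℤ} {u v w : V} {k : ℕ}
    (h₀ : d.mode (d.mode u (-1) v) q w ∈ P)
    (h₁ : ∀ i : ℕ, i ≠ k → d.mode u (-1 - i) (d.mode v (q + i) w) ∈ P)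
    (h₂ : ∀ i : ℕ, d.mode v (q - 1 - i) (d.mode u i w) ∈ P) :
    d.mode u (-1 - k) (d.mode v (q + k) w) ∈ P := by
  rw [d.iterate] at h₀
  simp only [neg_one_pow_mul_cbinom, one_smul, zpow_neg_one, inv_neg, inv_one, neg_smul,
    sub_neg_eq_add, ← sub_eq_add_neg] at h₀
  have hfin : (Function.support fun i : ℕ => d.mode u (-1 - i) (d.mode v (q + i) w) +
      d.mode v (q - 1 - i) (d.mode u i w)).Finite := by
    obtain ⟨N, hN⟩ := d.truncation u w
    obtain ⟨M, hM⟩ := d.truncation v w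
    refine (Set.finite_Iio (max N.toNat (M - q).toNat)).subset fun i hi => ?_
    by_contra hlt
    simp only [Set.mem_Iio, lt_max_iff, not_or, not_lt] at hlt
    exact hi (by simp only [hN i (by omega), hM (q + i) (by omega), map_zero, add_zero])
  have := mem_of_finsum_mem hfin (k := k) (fun i hi => P.add_mem (h₁ i hi) (h₂ i)) h₀
  exact (P.add_mem_iff_left (h₂ k)).1 this

end Basic

section Words

variable (d : VOA V)

/-- The operator `u¹_{-1-n₁} ⋯ u^k_{-1-n_k}` given by a word with letters `(uⁱ, nᵢ)`. -/
def act (L : List (V × ℕ)) : Module.End ℂ V :=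
  (L.map fun p => d.mode p.1 (-1 - p.2)).prod

@[simp] theorem act_nil (w : V) : d.act [] w = w := rfl

@[simp] theorem act_cons (p : V × ℕ) (L : List (V × ℕ)) (w : V) :
    d.act (p :: L) w = d.mode p.1 (-1 - p.2) (d.act L w) := by
  simp [act]

theorem act_append (L L' : List (V × ℕ)) (w : V) :
    d.act (L ++ L') w = d.act L (d.act L' w) := by
  simp [act]

/-- The degree `∑ nᵢ` of a word. -/
def wordDeg {α : Type*} (L : List (α × ℕ)) : ℕ := (L.map Prod.snd).sum

@[simp] theorem wordDeg_nil {α : Type*} : wordDeg ([] : List (α × ℕ)) = 0 := rfl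

@[simp] theorem wordDeg_cons {α : Type*} (p : α × ℕ) (L : List (α × ℕ)) :
    wordDeg (p :: L) = p.2 + wordDeg L := by simp [wordDeg]

theorem wordDeg_append {α : Type*} (L L' : List (α × ℕ)) :
    wordDeg (L ++ L') = wordDeg L + wordDeg L' := by
  simp [wordDeg]

theorem wordDeg_perm {α : Type*} {L L' : List (α × ℕ)} (h : L.Perm L') :
    wordDeg L = wordDeg L' :=
  (h.map _).sum_eq

theorem exists_split {α : Type*} {k : ℕ} (N : ℕ) (L : List (α × ℕ)) (hL : N ≤ wordDeg L)
    (hk : ∀ p ∈ L, p.2 ≤ k) :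
    ∃ L₁ L₂, L = L₁ ++ L₂ ∧ N ≤ wordDeg L₂ ∧ wordDeg L₂ ≤ N + k := by
  induction L with
  | nil => exact ⟨[], [], rfl, hL, by simp⟩
  | cons p L ih =>
    by_cases h : N ≤ wordDeg L
    · obtain ⟨L₁, L₂, rfl, h₁, h₂⟩ := ih h fun q hq => hk q (List.mem_cons_of_mem _ hq)
      exact ⟨p :: L₁, L₂, rfl, h₁, h₂⟩
    · refine ⟨[], p :: L, rfl, hL, ?_⟩
      have := hk p List.mem_cons_self
      simp only [wordDeg_cons]
      omega

end Words

section C2Type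

variable (d : VOA V)

/-- The span of all vectors `u_{-1-k} v`. -/
def cSpan (k : ℕ) : Submodule ℂ V :=
  Submodule.span ℂ {x : V | ∃ u v : V, x = d.mode u (-1 - k) v}

theorem cSpan_antitone : Antitone d.cSpan := by
  refine antitone_nat_of_succ_le fun k => Submodule.span_le.2 ?_
  rintro _ ⟨u, v, rfl⟩
  have h := d.Lneg1_deriv u (-1 - k)
  have hk : (1 + k : ℂ) ≠ 0 := by exact_mod_cast (by omega : 1 + k ≠ 0)
  have h' : d.mode u (-1 - (k + 1 : ℕ)) v =
      (1 + k : ℂ)⁻¹ • d.mode (d.mode d.conformal 0 u) (-1 - k) v := by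
    rw [h, LinearMap.smul_apply, smul_smul]
    push_cast
    rw [show -(-1 - (k : ℂ)) = 1 + k by ring, inv_mul_cancel₀ hk, one_smul, sub_sub]
  rw [h']
  exact Submodule.smul_mem _ _ (Submodule.subset_span ⟨_, _, rfl⟩)

theorem mode_mem_cSpan {k : ℕ} {m : ℤ} (hm : m ≤ -1 - k) (u v : V) : d.mode u m v ∈ d.cSpan k := by
  have hj : k ≤ (-1 - m).toNat := by omega
  refine d.cSpan_antitone hj (Submodule.subset_span ⟨u, v, ?_⟩)
  rw [show -1 - (((-1 - m).toNat : ℕ) : ℤ) = m by omega]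

theorem mode_mem_cSpan_of_mem {k : ℕ} (i : ℕ) (u : V) {x : V} (hx : x ∈ d.cSpan k) :
    d.mode u (-1 - i) x ∈ d.cSpan k := by
  refine (Submodule.span_le (p := (d.cSpan k).comap (d.mode u (-1 - i)))).2 ?_ hx
  rintro _ ⟨a, v, rfl⟩
  refine ((d.cSpan k).sub_mem_iff_left (d.mode_mem_cSpan le_rfl a (d.mode u (-1 - i) v))).1 ?_
  exact d.commutator_mem fun s => d.mode_mem_cSpan (by omega) _ _

theorem act_mem_cSpan_of_mem {k : ℕ} (L : List (V × ℕ)) {x : V} (hx : x ∈ d.cSpan k) :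
    d.act L x ∈ d.cSpan k := by
  induction L with
  | nil => exact hx
  | cons p L ih => exact d.mode_mem_cSpan_of_mem _ _ ih

theorem mode_cSpan_mem_succ {k : ℕ} (hk : 1 ≤ k) (u : V) {x : V} (hx : x ∈ d.cSpan k) :
    d.mode u (-1 - k) x ∈ d.cSpan (k + 1) := by
  refine (Submodule.span_le (p := (d.cSpan (k + 1)).comap (d.mode u (-1 - k)))).2 ?_ hx
  rintro _ ⟨v, w, rfl⟩
  have := d.mode_mode_mem_of_iterate (P := d.cSpan (k + 1)) (q := -1 - 2 * k) (u := u) (v := v)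
    (w := w) (k := k) (d.mode_mem_cSpan (by push_cast; omega) _ _) ?_
    fun i => d.mode_mem_cSpan (by push_cast; omega) _ _
  · rwa [show (-1 - 2 * k + k : ℤ) = -1 - k by ring] at this
  · intro i hi
    rcases lt_or_gt_of_ne hi with h | h
    · refine d.mode_mem_cSpan_of_mem _ _ (d.mode_mem_cSpan ?_ _ _)
      push_cast; omega
    · exact d.mode_mem_cSpan (by push_cast; omega) _ _

theorem act_mode_sub_mem {k : ℕ} (L : List (V × ℕ)) (u v : V) :
    d.act L (d.mode u (-1 - k) v) - d.mode u (-1 - k) (d.act L v) ∈ d.cSpan (k + 1) := by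
  induction L with
  | nil => simp
  | cons p L ih =>
    have h₁ := d.mode_mem_cSpan_of_mem p.2 p.1 ih
    have h₂ : d.mode p.1 (-1 - p.2) (d.mode u (-1 - k) (d.act L v)) -
        d.mode u (-1 - k) (d.mode p.1 (-1 - p.2) (d.act L v)) ∈ d.cSpan (k + 1) :=
      d.commutator_mem fun s => d.mode_mem_cSpan (by push_cast; omega) _ _
    rw [map_sub] at h₁
    simpa using (d.cSpan (k + 1)).add_mem h₁ h₂

theorem act_mem_cSpan_of_letter {k : ℕ} {L : List (V × ℕ)} (h : ∃ p ∈ L, k ≤ p.2) (w : V) :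
    d.act L w ∈ d.cSpan k := by
  obtain ⟨p, hp, hk⟩ := h
  obtain ⟨L₁, L₂, rfl⟩ := List.append_of_mem hp
  rw [act_append]
  exact d.act_mem_cSpan_of_mem _ (d.mode_mem_cSpan (by omega) _ _)

/-- Words of large degree lie in `cSpan (k + 1)`. -/
theorem exists_act_mem_cSpan (k : ℕ) :
    ∃ N : ℕ, ∀ L : List (V × ℕ), N ≤ wordDeg L → ∀ w, d.act L w ∈ d.cSpan (k + 1) := by
  induction k with
  | zero =>
    refine ⟨1, fun L hL w => d.act_mem_cSpan_of_letter ?_ w⟩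
    by_contra! h
    have : wordDeg L = 0 := by
      refine List.sum_eq_zero fun n hn => ?_
      obtain ⟨p, hp, rfl⟩ := List.mem_map.1 hn
      have := h p hp
      omega
    omega
  | succ k ih =>
    obtain ⟨N, hN⟩ := ih
    refine ⟨N + (N + (k + 2)), fun L hL w => ?_⟩
    by_cases h : ∃ p ∈ L, k + 2 ≤ p.2
    · exact d.act_mem_cSpan_of_letter h w
    push Not at h
    obtain ⟨L₁, L₂, rfl, h₁, h₂⟩ :=
      exists_split (k := k + 2) N L (by omega) fun p hp => (h p hp).le
    rw [wordDeg_append] at hL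
    rw [act_append]
    refine (Submodule.span_le (p := (d.cSpan (k + 2)).comap (d.act L₁))).2 ?_ (hN L₂ h₁ w)
    rintro _ ⟨u, v, rfl⟩
    exact ((d.cSpan _).sub_mem_iff_left (d.mode_cSpan_mem_succ (by omega) u
      (hN L₁ (by omega) v))).1 (d.act_mode_sub_mem L₁ u v)

end C2Type

section Filtration

variable (d : VOA V)

/-- Li's decreasing filtration: the span of all words of degree at least `n`. -/
def liFilt (n : ℤ) : Submodule ℂ V :=
  Submodule.span ℂ {x : V | ∃ L : List (V × ℕ), n ≤ wordDeg L ∧ x = d.act L d.vacuum}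

theorem act_mem_liFilt {n : ℤ} {L : List (V × ℕ)} (h : n ≤ wordDeg L) :
    d.act L d.vacuum ∈ d.liFilt n :=
  Submodule.subset_span ⟨L, h, rfl⟩

theorem liFilt_antitone : Antitone d.liFilt := fun _ _ h =>
  Submodule.span_mono fun _ ⟨L, hL, hx⟩ => ⟨L, h.trans hL, hx⟩

theorem mem_liFilt_zero (v : V) : v ∈ d.liFilt 0 := by
  have := d.act_mem_liFilt (n := 0) (L := [(v, 0)]) (by simp)
  simpa [d.creation_neg_one] using this

theorem mode_mem_liFilt_of_neg {m n : ℤ} (hm : m < 0) (u : V) {x : V} (hx : x ∈ d.liFilt n) :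
    d.mode u m x ∈ d.liFilt (n - m - 1) := by
  refine (Submodule.span_le (p := (d.liFilt (n - m - 1)).comap (d.mode u m))).2 ?_ hx
  rintro _ ⟨L, hL, rfl⟩
  have := d.act_mem_liFilt (n := n - m - 1) (L := (u, (-1 - m).toNat) :: L)
    (by simp only [wordDeg_cons]; omega)
  rw [act_cons] at this
  rwa [show -1 - (((-1 - m).toNat : ℕ) : ℤ) = m by omega] at this

theorem mode_act_mem_liFilt_of_nonneg (L : List (V × ℕ)) (u : V) {m : ℤ} (hm : 0 ≤ m) :
    d.mode u m (d.act L d.vacuum) ∈ d.liFilt (wordDeg L - m) := by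
  induction L generalizing u m with
  | nil => simp [d.creation u m hm]
  | cons p L ih =>
    rw [act_cons]
    have h₁ : d.mode p.1 (-1 - p.2) (d.mode u m (d.act L d.vacuum)) ∈
        d.liFilt (wordDeg (p :: L) - m) :=
      d.liFilt_antitone (by simp only [wordDeg_cons]; omega)
        (d.mode_mem_liFilt_of_neg (by omega) p.1 (ih u hm))
    refine (Submodule.sub_mem_iff_left _ h₁).1 (d.commutator_mem fun i => ?_)
    rcases lt_or_ge (m + (-1 - (p.2 : ℤ)) - i) 0 with h | h
    · exact d.liFilt_antitone (by simp only [wordDeg_cons]; omega)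
        (d.mode_mem_liFilt_of_neg h _ (d.act_mem_liFilt le_rfl))
    · exact d.liFilt_antitone (by simp only [wordDeg_cons]; omega) (ih _ h)

theorem mode_mem_liFilt_of_nonneg {m n : ℤ} (hm : 0 ≤ m) (u : V) {x : V} (hx : x ∈ d.liFilt n) :
    d.mode u m x ∈ d.liFilt (n - m) := by
  refine (Submodule.span_le (p := (d.liFilt (n - m)).comap (d.mode u m))).2 ?_ hx
  rintro _ ⟨L, hL, rfl⟩
  exact d.liFilt_antitone (by omega) (d.mode_act_mem_liFilt_of_nonneg L u hm)

theorem mode_mem_liFilt {m n k : ℤ} (hk : k ≤ n - m - 1) (u : V) {x : V} (hx : x ∈ d.liFilt n) :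
    d.mode u m x ∈ d.liFilt k := by
  rcases lt_or_ge m 0 with h | h
  · exact d.liFilt_antitone hk (d.mode_mem_liFilt_of_neg h u hx)
  · exact d.liFilt_antitone (by omega) (d.mode_mem_liFilt_of_nonneg h u hx)

/-- Letters from `C₂(V)` raise the degree. -/
theorem mode_C2_mem_liFilt {m n k : ℤ} (hk : k ≤ n - m) {u x : V} (hu : u ∈ d.C2)
    (hx : x ∈ d.liFilt n) : d.mode u m x ∈ d.liFilt k := by
  refine (Submodule.span_le (p := (d.liFilt k).comap (d.modeLeft m x))).2 ?_ hu
  rintro _ ⟨a, b, rfl⟩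
  change d.mode (d.mode a (-2) b) m x ∈ d.liFilt k
  refine d.iterate_mem (fun i => ?_) fun i => ?_
  · exact d.mode_mem_liFilt (n := n - (m + i) - 1) (by omega) _
      (d.mode_mem_liFilt le_rfl _ hx)
  · exact d.mode_mem_liFilt (n := n - i) (by omega) _
      (d.mode_mem_liFilt_of_nonneg (by omega) _ hx)

/-- Letters commute modulo words of larger degree. -/
theorem act_sub_act_mem_of_perm {L L' : List (V × ℕ)} (h : L.Perm L') :
    d.act L d.vacuum - d.act L' d.vacuum ∈ d.liFilt (wordDeg L + 1) := by
  induction h with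
  | nil => simp
  | cons p _ ih =>
    rw [act_cons, act_cons, ← map_sub]
    exact d.mode_mem_liFilt (by simp only [wordDeg_cons]; omega) _ ih
  | swap p q L =>
    simp only [act_cons]
    exact d.commutator_mem fun i =>
      d.mode_mem_liFilt (by simp only [wordDeg_cons]; omega) _ (d.act_mem_liFilt le_rfl)
  | trans h₁ _ ih₁ ih₂ =>
    rw [wordDeg_perm h₁] at ih₁ ⊢
    simpa using Submodule.add_mem _ ih₁ ih₂

end Filtration

section Rewriting

variable (d : VOA V)

/-- The span of the words with letters in `X` and strictly decreasing modes. -/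
def sortedSpan (X : Set V) : Submodule ℂ V :=
  Submodule.span ℂ {x : V | ∃ L : List (V × ℕ), (∀ p ∈ L, p.1 ∈ X) ∧
    L.Pairwise (fun p q => q.2 < p.2) ∧ x = d.act L d.vacuum}

/-- The span of the words with letters in `X` and prescribed modes. -/
def modeSpan (X : Set V) (ns : List ℕ) : Submodule ℂ V :=
  Submodule.span ℂ {x : V | ∃ L : List (V × ℕ), (∀ p ∈ L, p.1 ∈ X) ∧
    L.map Prod.snd = ns ∧ x = d.act L d.vacuum}

variable {X : Set V}

theorem modeSpan_le_sortedSpan {ns : List ℕ} (h : ns.Pairwise (· > ·)) :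
    d.modeSpan X ns ≤ d.sortedSpan X := by
  refine Submodule.span_mono ?_
  rintro _ ⟨L, hX, rfl, rfl⟩
  exact ⟨L, hX, List.pairwise_map.1 h, rfl⟩

theorem modeSpan_le_liFilt (ns : List ℕ) : d.modeSpan X ns ≤ d.liFilt ns.sum := by
  refine Submodule.span_mono ?_
  rintro _ ⟨L, _, rfl, rfl⟩
  exact ⟨L, le_rfl, rfl⟩

/-- The letters of a word can be taken in `X`, up to words of larger degree. -/
theorem act_mem_modeSpan_sup (hX : Submodule.span ℂ X ⊔ d.C2 = ⊤) (L : List (V × ℕ)) :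
    d.act L d.vacuum ∈ d.modeSpan X (L.map Prod.snd) ⊔ d.liFilt (wordDeg L + 1) := by
  induction L with
  | nil => exact Submodule.mem_sup_left (Submodule.subset_span ⟨[], by simp, rfl, rfl⟩)
  | cons p L ih =>
    rw [act_cons]
    obtain ⟨y, hy, z, hz, hyz⟩ := Submodule.mem_sup.1 ih
    rw [← hyz, map_add]
    refine Submodule.add_mem _ ?_ (Submodule.mem_sup_right
      (d.mode_mem_liFilt (by simp only [wordDeg_cons]; omega) _ hz))
    obtain ⟨a, ha, b, hb, hab⟩ :=
      Submodule.mem_sup.1 (hX.symm ▸ Submodule.mem_top : p.1 ∈ Submodule.span ℂ X ⊔ d.C2)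
    rw [← hab, d.mode_add, LinearMap.add_apply]
    refine Submodule.add_mem _ (Submodule.mem_sup_left ?_) (Submodule.mem_sup_right
      (d.mode_C2_mem_liFilt ?_ hb (d.modeSpan_le_liFilt _ hy)))
    · refine (Submodule.span_le (p := (d.modeSpan X _).comap (d.modeLeft (-1 - p.2) y))).2 ?_ ha
      intro u hu
      refine (Submodule.span_le (p := (d.modeSpan X _).comap (d.mode u (-1 - p.2)))).2 ?_ hy
      rintro _ ⟨L', hL', hs, rfl⟩
      refine Submodule.subset_span ⟨(u, p.2) :: L', ?_, by simp [hs], by simp⟩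
      simpa using ⟨hu, fun a b => hL' (a, b)⟩
    · simp only [wordDeg_cons, ← wordDeg.eq_1]
      omega

theorem exists_perm_of_not_nodup {α : Type*} {L : List (α × ℕ)} (h : ¬ (L.map Prod.snd).Nodup) :
    ∃ u v m L', L.Perm ((u, m) :: (v, m) :: L') := by
  induction L with
  | nil => simp at h
  | cons p L ih =>
    rw [List.map_cons, List.nodup_cons, not_and_or, not_not] at h
    rcases h with h | h
    · obtain ⟨q, hq, hqp⟩ := List.mem_map.1 h
      obtain ⟨L₁, L₂, rfl⟩ := List.append_of_mem hq
      refine ⟨p.1, q.1, p.2, L₁ ++ L₂, ?_⟩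
      rw [← hqp]
      nth_rewrite 1 [hqp]
      exact List.perm_middle.cons _
    · obtain ⟨u, v, m, L', hL'⟩ := ih h
      refine ⟨u, v, m, p :: L', (hL'.cons p).trans ?_⟩
      exact (List.Perm.swap _ _ _).trans ((List.Perm.swap _ _ _).cons _)

theorem exists_perm_pairwise_of_nodup {α : Type*} {L : List (α × ℕ)}
    (h : (L.map Prod.snd).Nodup) :
    ∃ L' : List (α × ℕ), L.Perm L' ∧ (L'.map Prod.snd).Pairwise (· > ·) := by
  let L' := L.mergeSort fun p q => decide (q.2 ≤ p.2)
  have hp : L.Perm L' := (List.mergeSort_perm _ _).symm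
  refine ⟨L', hp, ?_⟩
  have h₁ : L'.Pairwise fun p q => q.2 ≤ p.2 := by
    have := List.pairwise_mergeSort (le := fun p q : α × ℕ => decide (q.2 ≤ p.2))
      (by simp only [decide_eq_true_eq]; omega)
      (by simp only [Bool.or_eq_true, decide_eq_true_eq]; omega) L
    simpa using this
  have h₂ := (hp.map Prod.snd).nodup_iff.1 h
  exact List.pairwise_map.2 ((h₁.and (List.pairwise_map.1 h₂)).imp (by omega))

/-- The sum of the squares of the modes of a word. -/
def wordSq {α : Type*} (L : List (α × ℕ)) : ℕ := (L.map fun p => p.2 ^ 2).sum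

theorem wordSq_le {α : Type*} (L : List (α × ℕ)) : wordSq L ≤ wordDeg L ^ 2 := by
  induction L with
  | nil => simp [wordSq]
  | cons p L ih =>
    have : wordSq (p :: L) = p.2 ^ 2 + wordSq L := by simp [wordSq]
    rw [this, wordDeg_cons]
    nlinarith [Nat.zero_le (p.2 * wordDeg L)]

/-- Every word lies in the sorted span, up to words of larger degree. -/
theorem act_mem_sortedSpan_sup (hX : Submodule.span ℂ X ⊔ d.C2 = ⊤) (L : List (V × ℕ)) :
    d.act L d.vacuum ∈ d.sortedSpan X ⊔ d.liFilt (wordDeg L + 1) := by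
  induction hl : L.length using Nat.strong_induction_on generalizing L with
  | _ l ih₁ =>
  subst hl
  induction hk : wordDeg L ^ 2 - wordSq L using Nat.strong_induction_on generalizing L with
  | _ k ih₂ =>
  subst hk
  by_cases h : (L.map Prod.snd).Nodup
  · obtain ⟨L', hp, hs⟩ := exists_perm_pairwise_of_nodup h
    have h₁ := d.act_mem_modeSpan_sup hX L'
    rw [← wordDeg_perm hp] at h₁
    have h₂ := sup_le_sup_right (d.modeSpan_le_sortedSpan hs) _ h₁
    exact (Submodule.sub_mem_iff_left _ h₂).1
      (Submodule.mem_sup_right (d.act_sub_act_mem_of_perm hp))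
  · obtain ⟨u, v, m, L', hp⟩ := exists_perm_of_not_nodup h
    have hdeg : wordDeg L = 2 * m + wordDeg L' := by
      rw [wordDeg_perm hp]; simp; ring
    have hsq : wordSq L = 2 * m ^ 2 + wordSq L' := by
      rw [wordSq, (hp.map _).sum_eq]; simp [wordSq]; ring
    have hlen : L.length = L'.length + 2 := by rw [hp.length_eq]; simp
    refine (Submodule.sub_mem_iff_left _ ?_).1
      (Submodule.mem_sup_right (d.act_sub_act_mem_of_perm hp))
    have key := d.mode_mode_mem_of_iterate
      (P := d.sortedSpan X ⊔ d.liFilt (wordDeg L + 1)) (q := -1 - (2 * m : ℕ)) (u := u) (v := v)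
      (w := d.act L' d.vacuum) (k := m) ?_ (fun i hi => ?_)
      fun i => Submodule.mem_sup_right ?_
    · simpa [show (-1 - 2 * m + m : ℤ) = -1 - m by ring] using key
    · have := ih₁ (L'.length + 1) (by omega) ((d.mode u (-1) v, 2 * m) :: L') (by simp)
      rwa [wordDeg_cons, ← hdeg, act_cons] at this
    · rcases le_or_gt i (2 * m) with hi' | hi'
      · obtain ⟨j, hj⟩ := Nat.exists_eq_add_of_le hi'
        have hd : wordDeg ((u, i) :: (v, j) :: L') = wordDeg L := by
          simp only [wordDeg_cons]; omega
        have hs : wordSq ((u, i) :: (v, j) :: L') = i ^ 2 + j ^ 2 + wordSq L' := by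
          simp [wordSq, add_assoc]
        have hlt : 2 * m ^ 2 < i ^ 2 + j ^ 2 := by
          have hne : (i : ℤ) - m ≠ 0 := sub_ne_zero.2 (by exact_mod_cast hi)
          have hpos := sq_pos_of_ne_zero hne
          have hj' : (j : ℤ) = 2 * m - i := by omega
          zify
          rw [hj']
          nlinarith
        have hle := wordSq_le ((u, i) :: (v, j) :: L')
        have := ih₂ _ (by rw [hd] at hle ⊢; omega) ((u, i) :: (v, j) :: L')
          (fun l hl L hL => ih₁ l (by rw [hlen]; simpa [Nat.lt_succ_iff] using hl) L hL) rfl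
        rw [hd] at this
        simpa [show (-1 - 2 * m + i : ℤ) = -1 - j by omega] using this
      · refine Submodule.mem_sup_right (d.mode_mem_liFilt (n := wordDeg L' - (-1 - (2 * m : ℕ) + i))
          (by push_cast; omega) _ ?_)
        exact d.mode_mem_liFilt_of_nonneg (by push_cast; omega) _ (d.act_mem_liFilt le_rfl)
    · exact d.mode_mem_liFilt (n := wordDeg L' - i) (by push_cast; omega) _
        (d.mode_mem_liFilt_of_nonneg (by omega) _ (d.act_mem_liFilt le_rfl))

theorem sortedSpan_sup_liFilt (hX : Submodule.span ℂ X ⊔ d.C2 = ⊤) (n : ℕ) :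
    d.sortedSpan X ⊔ d.liFilt n = ⊤ := by
  induction n with
  | zero => exact eq_top_iff.2 fun v _ => Submodule.mem_sup_right (d.mem_liFilt_zero v)
  | succ n ih =>
    refine eq_top_iff.2 (ih.symm.le.trans (sup_le le_sup_left (Submodule.span_le.2 ?_)))
    rintro _ ⟨L, hL, rfl⟩
    rcases hL.eq_or_lt with h | h
    · have := d.act_mem_sortedSpan_sup hX L
      rw [← h] at this
      exact_mod_cast this
    · exact Submodule.mem_sup_right (d.act_mem_liFilt (by push_cast; omega))

theorem sortedSpan_sup_cSpan (hX : Submodule.span ℂ X ⊔ d.C2 = ⊤) (k : ℕ) :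
    d.sortedSpan X ⊔ d.cSpan (k + 1) = ⊤ := by
  obtain ⟨N, hN⟩ := d.exists_act_mem_cSpan k
  refine eq_top_iff.2 ((d.sortedSpan_sup_liFilt hX N).symm.le.trans (sup_le_sup_left ?_ _))
  refine Submodule.span_le.2 ?_
  rintro _ ⟨L, hL, rfl⟩
  exact hN L (by exact_mod_cast hL) _

end Rewriting

section Grading

variable (d : VOA V)

theorem decomp_of_mem {n : ℤ} {v : V} (hv : v ∈ d.grading n) :
    (LinearEquiv.ofBijective (DirectSum.coeLinearMap d.grading) d.internal).symm v =
      DirectSum.of (fun m => d.grading m) n ⟨v, hv⟩ := by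
  rw [LinearEquiv.symm_apply_eq, LinearEquiv.ofBijective_apply, DirectSum.coeLinearMap_of]

theorem proj_of_mem {n : ℤ} {v : V} (hv : v ∈ d.grading n) : d.proj n v = v := by
  simp only [proj, LinearMap.comp_apply, LinearEquiv.coe_coe, d.decomp_of_mem hv]
  exact congrArg Subtype.val (DirectSum.of_eq_same (β := fun m => d.grading m) n ⟨v, hv⟩)

theorem proj_of_mem_ne {n m : ℤ} (hnm : n ≠ m) {v : V} (hv : v ∈ d.grading n) :
    d.proj m v = 0 := by
  simp only [proj, LinearMap.comp_apply, LinearEquiv.coe_coe, d.decomp_of_mem hv]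
  exact congrArg Subtype.val
    (DirectSum.of_eq_of_ne (β := fun m => d.grading m) n m ⟨v, hv⟩ hnm.symm)

theorem iSup_grading : ⨆ n, d.grading n = ⊤ :=
  DirectSum.IsInternal.submodule_iSup_eq_top (A := d.grading) d.internal

theorem mem_of_grading_le {P : Submodule ℂ V} (h : ∀ n, d.grading n ≤ P) (v : V) : v ∈ P :=
  iSup_le h (d.iSup_grading.symm ▸ Submodule.mem_top)

theorem act_mem_grading {L : List (V × ℕ)} (h : ∀ p ∈ L, ∃ n, p.1 ∈ d.grading n) :
    ∃ n, d.act L d.vacuum ∈ d.grading n := by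
  induction L with
  | nil => exact ⟨0, d.vacuum_mem⟩
  | cons p L ih =>
    obtain ⟨r, hr⟩ := h p List.mem_cons_self
    obtain ⟨s, hs⟩ := ih fun q hq => h q (List.mem_cons_of_mem _ hq)
    exact ⟨_, by rw [act_cons]; exact d.grading_mode r s _ _ _ hr hs⟩

theorem proj_mem_sortedSpan {X : Set V} (hX : ∀ x ∈ X, ∃ n, x ∈ d.grading n) (m : ℤ) {v : V}
    (hv : v ∈ d.sortedSpan X) : d.proj m v ∈ d.sortedSpan X := by
  refine (Submodule.span_le (p := (d.sortedSpan X).comap (d.proj m))).2 ?_ hv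
  rintro _ ⟨L, hL, hs, rfl⟩
  obtain ⟨n, hn⟩ := d.act_mem_grading fun p hp => hX _ (hL p hp)
  change d.proj m _ ∈ d.sortedSpan X
  by_cases h : n = m
  · subst h
    rw [d.proj_of_mem hn]
    exact Submodule.subset_span ⟨L, hL, hs, rfl⟩
  · rw [d.proj_of_mem_ne h hn]
    exact Submodule.zero_mem _

theorem exists_proj_cSpan_eq_zero (m : ℤ) :
    ∃ k : ℕ, ∀ x ∈ d.cSpan (k + 1), d.proj m x = 0 := by
  obtain ⟨N, hN⟩ := d.bounded_below
  refine ⟨(m - 2 * N).toNat, fun x hx => ?_⟩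
  generalize hk : (m - 2 * N).toNat + 1 = k at hx
  have key : ∀ r s : ℤ, ∀ u ∈ d.grading r, ∀ v ∈ d.grading s,
      d.proj m (d.mode u (-1 - k) v) = 0 := by
    intro r s u hu v hv
    rcases lt_or_ge r N with hr | hr
    · rw [hN r hr, Submodule.mem_bot] at hu
      simp [hu, d.mode_zero_left]
    rcases lt_or_ge s N with hs | hs
    · rw [hN s hs, Submodule.mem_bot] at hv
      simp [hv]
    · exact d.proj_of_mem_ne (by omega) (d.grading_mode r s _ u v hu hv)
  refine (Submodule.span_le (p := LinearMap.ker (d.proj m))).2 ?_ hx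
  rintro _ ⟨u, v, rfl⟩
  exact d.mem_of_grading_le (P := LinearMap.ker (d.proj m ∘ₗ d.modeLeft (-1 - k) v))
    (fun r u hu => d.mem_of_grading_le (P := LinearMap.ker (d.proj m ∘ₗ d.mode u (-1 - k)))
      (fun s v hv => key r s u hu v hv) v) u

theorem sortedSpan_eq_top {X : Set V} (hhom : ∀ x ∈ X, ∃ n, x ∈ d.grading n)
    (hX : Submodule.span ℂ X ⊔ d.C2 = ⊤) : d.sortedSpan X = ⊤ := by
  rw [eq_top_iff, ← d.iSup_grading]
  refine iSup_le fun m v hv => ?_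
  obtain ⟨k, hk⟩ := d.exists_proj_cSpan_eq_zero m
  obtain ⟨s, hs, c, hc, rfl⟩ := Submodule.mem_sup.1
    (d.sortedSpan_sup_cSpan hX k ▸ Submodule.mem_top : v ∈ d.sortedSpan X ⊔ d.cSpan (k + 1))
  rw [← d.proj_of_mem hv, map_add, hk c hc, add_zero]
  exact d.proj_mem_sortedSpan hhom m hs

theorem modeSeq_eq_act (k : ℕ) (xs : Fin k → V) (ns : Fin k → ℕ) :
    d.modeSeq k xs (fun i => ns i + 1) = d.act (List.ofFn fun i => (xs i, ns i)) d.vacuum := by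
  have h : ∀ L : List (Module.End ℂ V), L.foldr (fun f w => f w) d.vacuum = L.prod d.vacuum := by
    intro L
    induction L with
    | nil => rfl
    | cons f L ih => simp [ih]
  rw [modeSeq, h, act, List.map_ofFn]
  congr 4
  funext i
  simp only [Function.comp_apply]
  congr 1
  push_cast
  ring

end Grading

end VOA

/-- PBW-like spanning set for a `C₂`-cofinite vertex operator algebra, and the
consequence that `V` is finitely generated. -/
theorem stmt9 (d : VOA V) (hC2 : FiniteDimensional ℂ (V ⧸ d.C2))
    {I : Type} (X : I → V) (hhom : ∀ α, ∃ n : ℤ, X α ∈ d.grading n)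
    (hli : LinearIndependent ℂ fun α => d.C2.mkQ (X α))
    (hspan : Submodule.span ℂ (Set.range fun α => d.C2.mkQ (X α)) = ⊤) :
    (Submodule.span ℂ {w : V | ∃ (k : ℕ) (xs : Fin k → V) (ns : Fin k → ℕ),
        (∀ i, ∃ α, xs i = X α) ∧ (∀ i j : Fin k, i < j → ns j < ns i) ∧
        (∀ i, 0 < ns i) ∧ w = d.modeSeq k xs ns} = ⊤) ∧
    (∃ S : Finset V, ∀ P : Submodule ℂ V, d.vacuum ∈ P → (↑S : Set V) ⊆ (P : Set V) →
        (∀ u ∈ P, ∀ (n : ℤ), ∀ w ∈ P, d.mode u n w ∈ P) → P = ⊤) := by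
  set Xs : Set V := Set.range X
  have hX : Submodule.span ℂ Xs ⊔ d.C2 = ⊤ := by
    rw [Set.range_comp' d.C2.mkQ X, Submodule.span_image] at hspan
    rw [sup_comm, ← Submodule.comap_map_mkQ, hspan, Submodule.comap_top]
  have htop := d.sortedSpan_eq_top (X := Xs) (by rintro _ ⟨α, rfl⟩; exact hhom α) hX
  refine ⟨?_, ?_⟩
  · rw [eq_top_iff, ← htop]
    refine Submodule.span_mono ?_
    rintro _ ⟨L, hL, hs, rfl⟩
    refine ⟨L.length, fun i => (L.get i).1, fun i => (L.get i).2 + 1, fun i => ?_,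
      fun i j hij => Nat.succ_lt_succ (List.pairwise_iff_get.1 hs i j hij),
      fun i => Nat.succ_pos _, ?_⟩
    · obtain ⟨α, hα⟩ := hL _ (L.get_mem i)
      exact ⟨α, hα.symm⟩
    · rw [d.modeSeq_eq_act, List.ofFn_get]
  · have : Finite I := hli.finite_of_isNoetherian
    refine ⟨(Set.finite_range X).toFinset, fun P hvac hXP hP => ?_⟩
    rw [Set.Finite.coe_toFinset] at hXP
    rw [eq_top_iff, ← htop]
    refine Submodule.span_le.2 ?_
    rintro _ ⟨L, hL, -, rfl⟩
    change d.act L d.vacuum ∈ P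
    induction L with
    | nil => exact hvac
    | cons p L ih =>
      rw [VOA.act_cons]
      exact hP _ (hXP (hL p List.mem_cons_self)) _ _
        (ih fun q hq => hL q (List.mem_cons_of_mem _ hq))
end

section
/- For n ≥ 1, the identity map on V induces a surjective algebra homomorphism from A_n(V) to A_{n-1}(V). -/
variable {V : Type} [AddCommGroup V] [Module ℂ V]

variable {M : Type} [AddCommGroup M] [Module ℂ M]

section ModeCalculus

lemma cbinom_zero_right (N : ℤ) : cbinom N 0 = 1 := by simp [cbinom]

lemma cbinom_succ_right (N : ℤ) (k : ℕ) :
    ((k : ℂ) + 1) * cbinom N (k + 1) = ((N : ℂ) - k) * cbinom N k := by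
  have h1 : (Nat.factorial k : ℂ) ≠ 0 := by exact_mod_cast Nat.factorial_ne_zero k
  have h2 : (k : ℂ) + 1 ≠ 0 := by exact_mod_cast Nat.succ_ne_zero k
  unfold cbinom
  rw [Finset.prod_range_succ, Nat.factorial_succ]
  push_cast
  field_simp

lemma cbinom_succ_succ_mul (N : ℤ) (k : ℕ) :
    ((k : ℂ) + 1) * cbinom (N + 1) (k + 1) = ((N : ℂ) + 1) * cbinom N k := by
  have h1 : (Nat.factorial k : ℂ) ≠ 0 := by exact_mod_cast Nat.factorial_ne_zero k
  have h2 : (k : ℂ) + 1 ≠ 0 := by exact_mod_cast Nat.succ_ne_zero k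
  unfold cbinom
  rw [Finset.prod_range_succ', Nat.factorial_succ]
  push_cast
  simp only [add_sub_add_right_eq_sub, sub_zero]
  field_simp

lemma cbinom_pascal (N : ℤ) (k : ℕ) :
    cbinom (N + 1) (k + 1) = cbinom N (k + 1) + cbinom N k := by
  have h2 : (k : ℂ) + 1 ≠ 0 := by exact_mod_cast Nat.succ_ne_zero k
  apply mul_left_cancel₀ h2
  linear_combination cbinom_succ_succ_mul N k - cbinom_succ_right N k

lemma cbinom_self_succ (k : ℕ) : cbinom (k : ℤ) (k + 1) = 0 := by
  have h2 : (k : ℂ) + 1 ≠ 0 := by exact_mod_cast Nat.succ_ne_zero k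
  apply mul_left_cancel₀ h2
  rw [cbinom_succ_right]
  simp

lemma VOA.mode_zero (d : VOA V) (n : ℤ) : d.mode 0 n = 0 := by
  simpa using d.mode_smul 0 0 n

lemma VOA.hres_zero (d : VOA V) (N k : ℤ) (v : V) : d.hres N k 0 v = 0 := by
  simp [VOA.hres, d.mode_zero]

lemma VOA.exists_mode_eq_zero (d : VOA V) (u v : V) (k : ℤ) :
    ∃ B : ℕ, ∀ i : ℕ, B ≤ i → d.mode u ((i : ℤ) - k) v = 0 := by
  obtain ⟨N, hN⟩ := d.truncation u v
  exact ⟨(N + k).toNat, fun i hi => hN _ (by omega)⟩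

lemma VOA.hres_eq_sum (d : VOA V) (N k : ℤ) (u v : V) (B : ℕ)
    (hB : ∀ i : ℕ, B ≤ i → d.mode u ((i : ℤ) - k) v = 0) :
    d.hres N k u v = ∑ i ∈ Finset.range B, cbinom N i • d.mode u ((i : ℤ) - k) v := by
  refine finsum_eq_sum_of_support_subset _ fun i hi => ?_
  by_contra h
  exact hi (by simp only [hB i (by simpa using h), smul_zero])

lemma VOA.hres_succ (d : VOA V) (N k : ℤ) (u v : V) :
    d.hres (N + 1) (k + 1) u v = d.hres N (k + 1) u v + d.hres N k u v := by
  obtain ⟨B, hB⟩ := d.exists_mode_eq_zero u v k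
  have hB' : ∀ i : ℕ, B + 1 ≤ i → d.mode u ((i : ℤ) - (k + 1)) v = 0 := fun i hi => by
    have := hB (i - 1) (by omega)
    rwa [show ((i - 1 : ℕ) : ℤ) - k = (i : ℤ) - (k + 1) by omega] at this
  rw [d.hres_eq_sum _ _ _ _ _ hB', d.hres_eq_sum _ _ _ _ _ hB', d.hres_eq_sum _ _ _ _ _ hB,
    Finset.sum_range_succ', Finset.sum_range_succ', add_right_comm, ← Finset.sum_add_distrib]
  simp only [cbinom_zero_right]
  congr 1
  refine Finset.sum_congr rfl fun i _ => ?_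
  rw [cbinom_pascal, add_smul]
  congr 4
  push_cast
  ring

/-- Integration by parts for `Y(L(-1)u, z) = d/dz Y(u, z)`. -/
lemma VOA.hres_derivative (d : VOA V) (N k : ℤ) (u v : V) :
    d.hres (N + 1) k (d.mode d.conformal 0 u) v =
      (k : ℂ) • d.hres (N + 1) (k + 1) u v - ((N : ℂ) + 1) • d.hres N k u v := by
  obtain ⟨B, hB⟩ := d.exists_mode_eq_zero u v k
  have hB' : ∀ i : ℕ, B + 1 ≤ i → d.mode u ((i : ℤ) - (k + 1)) v = 0 := fun i hi => by
    have := hB (i - 1) (by omega)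
    rwa [show ((i - 1 : ℕ) : ℤ) - k = (i : ℤ) - (k + 1) by omega] at this
  have hB'' : ∀ i : ℕ, B + 1 ≤ i → d.mode (d.mode d.conformal 0 u) ((i : ℤ) - k) v = 0 :=
    fun i hi => by
      have := hB' i hi
      rw [d.Lneg1_deriv, LinearMap.smul_apply, sub_sub, this, smul_zero]
  rw [d.hres_eq_sum _ _ _ _ _ hB', d.hres_eq_sum _ _ _ _ _ hB'', d.hres_eq_sum _ _ _ _ _ hB,
    Finset.smul_sum, Finset.smul_sum, Finset.sum_range_succ', Finset.sum_range_succ',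
    add_sub_right_comm, ← Finset.sum_sub_distrib]
  simp only [d.Lneg1_deriv, LinearMap.smul_apply, sub_sub]
  congr 1
  · refine Finset.sum_congr rfl fun i _ => ?_
    rw [show ((i + 1 : ℕ) : ℤ) - (k + 1) = (i : ℤ) - k by push_cast; ring, smul_smul, smul_smul,
      smul_smul, ← sub_smul, ← cbinom_succ_succ_mul]
    congr 1
    push_cast
    ring
  · rw [smul_smul, smul_smul]
    congr 1
    push_cast
    ring

lemma VOA.proj_mem (d : VOA V) (n : ℤ) (u : V) : d.proj n u ∈ d.grading n := by
  simp [VOA.proj]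

lemma VOA.finite_support_proj (d : VOA V) (u : V) : {n : ℤ | d.proj n u ≠ 0}.Finite := by
  classical
  refine (DFinsupp.support
    ((LinearEquiv.ofBijective (DirectSum.coeLinearMap d.grading) d.internal).symm u)
    ).finite_toSet.subset fun n hn => ?_
  rw [Finset.mem_coe, DFinsupp.mem_support_iff]
  intro h
  refine hn ?_
  simp only [VOA.proj, LinearMap.comp_apply, Submodule.subtype_apply, ZeroMemClass.coe_eq_zero]
  exact h

lemma VOA.symm_of_mem (d : VOA V) {w : ℤ} {u : V} (hu : u ∈ d.grading w) :
    (LinearEquiv.ofBijective (DirectSum.coeLinearMap d.grading) d.internal).symm u =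
      DirectSum.lof ℂ ℤ (fun m => d.grading m) w ⟨u, hu⟩ := by
  rw [LinearEquiv.symm_apply_eq, LinearEquiv.ofBijective_apply, DirectSum.coeLinearMap_lof]

lemma VOA.proj_of_mem_s11 (d : VOA V) {w : ℤ} {u : V} (hu : u ∈ d.grading w) : d.proj w u = u := by
  simp [VOA.proj, d.symm_of_mem hu, DirectSum.component.lof_self]

lemma VOA.proj_of_mem_of_ne (d : VOA V) {w n : ℤ} {u : V} (hu : u ∈ d.grading w) (h : n ≠ w) :
    d.proj n u = 0 := by
  simp [VOA.proj, d.symm_of_mem hu, DirectSum.component.of, h.symm]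

lemma VOA.bres_of_mem (d : VOA V) {w : ℤ} {u : V} (hu : u ∈ d.grading w) (m k : ℤ) (v : V) :
    d.bres m k u v = d.hres (w + m) k u v := by
  rw [VOA.bres, finsum_eq_single _ w fun n hn => by rw [d.proj_of_mem_of_ne hu hn, d.hres_zero],
    d.proj_of_mem_s11 hu]

lemma VOA.bres_succ (d : VOA V) (m k : ℤ) (u v : V) :
    d.bres (m + 1) (k + 1) u v = d.bres m (k + 1) u v + d.bres m k u v := by
  have hfin : ∀ l : ℤ, (Function.support fun n : ℤ => d.hres (n + m) l (d.proj n u) v).Finite :=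
    fun l => (d.finite_support_proj u).subset fun n hn h =>
      hn (by simp only [h, d.hres_zero])
  simp only [VOA.bres]
  rw [← finsum_add_distrib (hfin _) (hfin _)]
  exact finsum_congr fun n => by rw [← add_assoc, d.hres_succ]

lemma VOA.hres_mem_On (d : VOA V) (N j : ℕ) {w : ℤ} {u : V} (hu : u ∈ d.grading w) (v : V) :
    d.hres (w + N) (2 * N + 2 + j) u v ∈ d.On N := by
  induction j generalizing w u with
  | zero =>
    refine Submodule.subset_span (Or.inl ⟨u, v, ?_⟩)
    rw [VOA.circn, d.bres_of_mem hu]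
    simp
  | succ j ih =>
    have hL : d.mode d.conformal 0 u ∈ d.grading (w + 1) := by
      have := d.grading_mode 2 w 0 _ _ d.conformal_mem hu
      rwa [show 2 + w - 0 - 1 = w + 1 by ring] at this
    have h1 := ih hu
    have h2 := ih hL
    rw [add_right_comm, d.hres_derivative, d.hres_succ] at h2
    have h3 := (Submodule.sub_mem_iff_left _ (Submodule.smul_mem _ _ h1)).1 h2
    have hk : (((2 * N + 2 + j : ℤ)) : ℂ) ≠ 0 := by
      rw [Int.cast_ne_zero]
      omega
    have h4 := (Submodule.smul_mem_iff _ hk).1 h3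
    rw [Submodule.add_mem_iff_left _ h1] at h4
    push_cast
    rwa [← add_assoc]

lemma VOA.bres_mem_On (d : VOA V) (N : ℕ) {k : ℤ} (hk : 2 * (N : ℤ) + 2 ≤ k) (u v : V) :
    d.bres N k u v ∈ d.On N := by
  obtain ⟨j, rfl⟩ := Int.exists_add_of_le hk
  exact finsum_induction (· ∈ d.On N) (Submodule.zero_mem _)
    (fun _ _ => Submodule.add_mem _) fun n => d.hres_mem_On N j (d.proj_mem n u) v

lemma VOA.On_succ_le (d : VOA V) (N : ℕ) : d.On (N + 1) ≤ d.On N := by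
  refine Submodule.span_le.2 ?_
  rintro _ (⟨u, v, rfl⟩ | ⟨u, rfl⟩)
  · have h : d.circn (N + 1) u v = d.bres N (2 * N + 4) u v + d.bres N (2 * N + 3) u v := by
      rw [show (2 * N + 4 : ℤ) = 2 * N + 3 + 1 by ring, ← d.bres_succ, VOA.circn]
      congr 1
    rw [h]
    exact Submodule.add_mem _ (d.bres_mem_On N (by omega) u v) (d.bres_mem_On N (by omega) u v)
  · exact Submodule.subset_span (Or.inr ⟨u, rfl⟩)

/-- Summation by parts for the coefficients of `*_n`. -/
lemma sum_cbinom_telescope {W : Type*} [AddCommGroup W] [Module ℂ W] (N M : ℕ) (g : ℕ → W) :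
    ∑ m ∈ Finset.range (M + 1),
        ((-1 : ℂ) ^ m * cbinom ((m : ℤ) + (N + 1 : ℕ)) (N + 1)) • (g (m + 1) + g m) =
      ∑ m ∈ Finset.range (M + 1), ((-1 : ℂ) ^ m * cbinom ((m : ℤ) + N) N) • g m +
        ((-1 : ℂ) ^ M * cbinom ((M : ℤ) + (N + 1 : ℕ)) (N + 1)) • g (M + 1) := by
  have pascal (m : ℤ) : cbinom (m + (N + 1 : ℕ)) (N + 1) =
      cbinom (m + N) (N + 1) + cbinom (m + N) N := by
    rw [← cbinom_pascal]
    push_cast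
    rw [add_assoc]
  induction M with
  | zero =>
    have h : cbinom ((0 : ℤ) + (N + 1 : ℕ)) (N + 1) = cbinom ((0 : ℤ) + N) N := by
      rw [pascal, zero_add, cbinom_self_succ, zero_add]
    simp only [zero_add, Finset.sum_range_one, Nat.cast_zero] at h ⊢
    rw [h]
    module
  | succ M ih =>
    rw [Finset.sum_range_succ, ih, Finset.sum_range_succ _ (M + 1), pascal ((M + 1 : ℕ) : ℤ),
      show ((M : ℤ) + (N + 1 : ℕ)) = ((M + 1 : ℕ) : ℤ) + N by push_cast; ring]
    module

lemma VOA.starn_succ_sub_mem (d : VOA V) (N : ℕ) (u v : V) :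
    d.starn (N + 1) u v - d.starn N u v ∈ d.On N := by
  have h : d.starn (N + 1) u v = ∑ m ∈ Finset.range (N + 1 + 1),
      ((-1 : ℂ) ^ m * cbinom ((m : ℤ) + (N + 1 : ℕ)) (N + 1)) •
        (d.bres N ((N : ℤ) + ((m + 1 : ℕ) : ℤ) + 1) u v + d.bres N ((N : ℤ) + m + 1) u v) := by
    refine Finset.sum_congr rfl fun m _ => ?_
    rw [show (N : ℤ) + ((m + 1 : ℕ) : ℤ) + 1 = (N : ℤ) + m + 1 + 1 by push_cast; ring,
      ← d.bres_succ]
    congr 2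
    push_cast
    ring
  rw [h, sum_cbinom_telescope N (N + 1) fun m => d.bres N ((N : ℤ) + m + 1) u v,
    Finset.sum_range_succ, VOA.starn, add_assoc, add_sub_cancel_left]
  exact Submodule.add_mem _
    (Submodule.smul_mem _ _ (d.bres_mem_On N (by push_cast; omega) u v))
    (Submodule.smul_mem _ _ (d.bres_mem_On N (by push_cast; omega) u v))

end ModeCalculus

/-- for `n ≥ 1` the identity map of `V` induces a surjective algebra
homomorphism `A_n(V) → A_{n-1}(V)`, i.e. `O_n(V) ⊆ O_{n-1}(V)` and the products `*_n`
and `*_{n-1}` agree modulo `O_{n-1}(V)`. -/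
theorem stmt11 (d : VOA V) (n : ℕ) (hn : 1 ≤ n) :
    d.On n ≤ d.On (n - 1) ∧
    ∀ u v : V, d.starn n u v - d.starn (n - 1) u v ∈ d.On (n - 1) := by
  obtain ⟨N, rfl⟩ := Nat.exists_eq_add_of_le' hn
  exact ⟨d.On_succ_le N, d.starn_succ_sub_mem N⟩
end
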